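/- Assume in addition that the map i : V → H is a compact operator. Let g, g₁, g₂, … : [0,T] → H be continuous controls such that sup_n ∫₀ᵀ ‖gₙ(t)‖_H² dt < ∞ and, for every continuous φ : [0,T] → H, ∫₀ᵀ ⟨gₙ(t) − g(t), φ(t)⟩_H dt → 0 as n → ∞. Let (uₙ,uₙ') and (u,u') be strong solutions of the parabolic variational inequality with controls gₙ and g respectively, all with the same initial value u_b. Then ∫₀ᵀ ‖uₙ(t) − u(t)‖_V² dt → 0 and sup_{t∈[0,T]} ‖i(uₙ(t)) − i(u(t))‖_H → 0 as n → ∞. -/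

import Mathlib

open scoped RealInnerProductSpace

/-- A strong solution of the parabolic variational inequality of the second kind:
`u : [0,T] → K` and `u' : [0,T] → H` are continuous, `i ∘ u` has derivative
`u'(t)` at every `t ∈ [0,T]`, `u(0) = u_b`, and for every `t ∈ [0,T]` and `v ∈ K`:
`⟨u'(t), i v − i u(t)⟩_H + a(u(t), v − u(t)) + Φ(v) − Φ(u(t)) ≥ ⟨g(t), i v − i u(t)⟩_H`. -/
def IsStrongSolution {V H : Type*} [NormedAddCommGroup V] [InnerProductSpace ℝ V]
    [NormedAddCommGroup H] [InnerProductSpace ℝ H]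
    (i : V →L[ℝ] H) (a : V →L[ℝ] V →L[ℝ] ℝ) (Φ : V → ℝ) (K : Set V)
    (T : ℝ) (u_b : V) (g : ℝ → H) (u : ℝ → V) (u' : ℝ → H) : Prop :=
  Continuous u ∧ Continuous u' ∧
  (∀ t ∈ Set.Icc (0 : ℝ) T, u t ∈ K) ∧
  (∀ t ∈ Set.Icc (0 : ℝ) T, HasDerivAt (fun s => i (u s)) (u' t) t) ∧
  u 0 = u_b ∧
  ∀ t ∈ Set.Icc (0 : ℝ) T, ∀ v ∈ K,
    ⟪u' t, i v - i (u t)⟫ + a (u t) (v - u t) + Φ v - Φ (u t)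
      ≥ ⟪g t, i v - i (u t)⟫

open Set Filter Topology

lemma aux_mono {f g : ℝ → ℝ} (hf : Continuous f) (hg : Continuous g) {a b : ℝ} (hab : a ≤ b)
    (h : ∀ x ∈ Icc a b, f x ≤ g x) : ∫ x in a..b, f x ≤ ∫ x in a..b, g x :=
  intervalIntegral.integral_mono_on hab (hf.intervalIntegrable _ _) (hg.intervalIntegrable _ _) h

lemma aux_mono_int {f : ℝ → ℝ} (hf : Continuous f) (h0 : ∀ x, 0 ≤ f x) {a b c d : ℝ}
    (hca : c ≤ a) (hab : a ≤ b) (hbd : b ≤ d) :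
    ∫ x in a..b, f x ≤ ∫ x in c..d, f x :=
  intervalIntegral.integral_mono_interval hca hab hbd (Eventually.of_forall h0)
    (hf.intervalIntegrable _ _)

lemma aux_ftc {E e : ℝ → ℝ} (he : Continuous e) {T a b : ℝ} (ha : 0 ≤ a)
    (hab : a ≤ b) (hb : b ≤ T)
    (hd : ∀ t ∈ Icc 0 T, HasDerivWithinAt E (e t) (Icc 0 T) t) :
    ∫ t in a..b, e t = E b - E a := by
  apply intervalIntegral.integral_eq_sub_of_hasDerivAt_of_le hab
  · intro t ht
    exact ((hd t ⟨ha.trans ht.1, ht.2.trans hb⟩).continuousWithinAt).mono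
      (Icc_subset_Icc ha hb)
  · intro t ht
    exact (hd t ⟨ha.trans ht.1.le, ht.2.le.trans hb⟩).hasDerivAt
      (Icc_mem_nhds (ha.trans_lt ht.1) (ht.2.trans_le hb))
  · exact he.intervalIntegrable _ _

lemma aux_lim {x X Z : ℕ → ℝ} {M : ℝ} (hx : ∀ n, 0 ≤ x n)
    (h : ∀ n, ∀ η > 0, x n ≤ η * M + X n / η + Z n)
    (hX : Tendsto X atTop (𝓝 0)) (hZ : Tendsto Z atTop (𝓝 0)) : Tendsto x atTop (𝓝 0) := by
  rw [Metric.tendsto_atTop]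
  intro ε hε
  set η : ℝ := ε / (2 * (|M| + 1)) with hη
  have hM : 0 < |M| + 1 := by positivity
  have hη0 : 0 < η := by positivity
  have hηM : η * M ≤ ε / 2 := by
    calc η * M ≤ η * (|M| + 1) := by
          apply mul_le_mul_of_nonneg_left _ hη0.le
          linarith [le_abs_self M]
      _ = ε / 2 := by rw [hη]; field_simp
  have hlim : Tendsto (fun n => X n / η + Z n) atTop (𝓝 0) := by
    simpa using (hX.div_const η).add hZ
  obtain ⟨N, hN⟩ := eventually_atTop.1 (hlim.eventually (gt_mem_nhds (half_pos hε)))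
  refine ⟨N, fun n hn => ?_⟩
  rw [Real.dist_eq, sub_zero, abs_of_nonneg (hx n)]
  linarith [h n η hη0, hN n hn]

section
variable {V H : Type*} [NormedAddCommGroup V] [InnerProductSpace ℝ V]
    [NormedAddCommGroup H] [InnerProductSpace ℝ H]

lemma aux_amgm (x y : H) {η : ℝ} (hη : 0 < η) : ⟪x, y⟫ ≤ η * ‖x‖ ^ 2 + ‖y‖ ^ 2 / η := by
  have h1 := real_inner_le_norm x y
  have h2 : 0 ≤ ‖x‖ * ‖y‖ := by positivity
  have h3 : 2 * (‖x‖ * ‖y‖) ≤ η * ‖x‖ ^ 2 + ‖y‖ ^ 2 / η := by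
    have : η * ‖x‖ ^ 2 + ‖y‖ ^ 2 / η - 2 * (‖x‖ * ‖y‖) = (η * ‖x‖ - ‖y‖) ^ 2 / η := by
      field_simp; ring
    have : 0 ≤ (η * ‖x‖ - ‖y‖) ^ 2 / η := by positivity
    linarith
  linarith

lemma aux_amgm_int {h y : ℝ → H} (hh : Continuous h) (hy : Continuous y) {η t T : ℝ} (hη : 0 < η)
    (ht : t ∈ Icc 0 T) : ∫ s in (0:ℝ)..t, ⟪h s, y s⟫ ≤
      η * (∫ s in (0:ℝ)..T, ‖h s‖ ^ 2) + (∫ s in (0:ℝ)..T, ‖y s‖ ^ 2) / η := by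
  have h1 : Continuous fun s => η * ‖h s‖ ^ 2 := by fun_prop
  have h2 : Continuous fun s => ‖y s‖ ^ 2 / η := by fun_prop
  calc ∫ s in (0:ℝ)..t, ⟪h s, y s⟫
      ≤ ∫ s in (0:ℝ)..t, (η * ‖h s‖ ^ 2 + ‖y s‖ ^ 2 / η) :=
        aux_mono (by fun_prop) (h1.add h2) ht.1 fun s _ => aux_amgm _ _ hη
    _ ≤ ∫ s in (0:ℝ)..T, (η * ‖h s‖ ^ 2 + ‖y s‖ ^ 2 / η) :=
        aux_mono_int (h1.add h2) (fun s => add_nonneg (by positivity) (by positivity)) le_rfl ht.1 ht.2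
    _ = _ := by
        rw [intervalIntegral.integral_add (h1.intervalIntegrable _ _) (h2.intervalIntegrable _ _),
          intervalIntegral.integral_const_mul, intervalIntegral.integral_div]

lemma aux_minorant {Φ : V → ℝ} (hc : ConvexOn ℝ univ Φ) (hcont : Continuous Φ) :
    ∃ B : ℝ, ∀ v, Φ 0 - B * ‖v‖ ≤ Φ v := by
  obtain ⟨δ, hδ, hd⟩ := Metric.continuous_iff.1 hcont 0 1 one_pos
  refine ⟨2 / δ, fun v => ?_⟩
  rcases eq_or_ne v 0 with rfl | hv
  · simp
  have hv' : 0 < ‖v‖ := norm_pos_iff.2 hv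
  set d := δ / 2 with hdd
  have hd0 : 0 < d := half_pos hδ
  set x : V := (-(d / ‖v‖)) • v with hx
  have hxn : ‖x‖ = d := by
    rw [hx, norm_smul, norm_neg, Real.norm_of_nonneg (by positivity : 0 ≤ d / ‖v‖)]; field_simp
  have h1 := hd x (by rw [dist_zero_right, hxn]; linarith)
  rw [Real.dist_eq] at h1
  have h2 := (abs_lt.1 h1).2
  have h3 := hc.2 (mem_univ v) (mem_univ x) 
    (by positivity : 0 ≤ d / (‖v‖ + d)) (by positivity : 0 ≤ ‖v‖ / (‖v‖ + d))
    (by field_simp; ring)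
  have h4 : (d / (‖v‖ + d)) • v + (‖v‖ / (‖v‖ + d)) • x = 0 := by
    rw [hx, smul_smul, ← add_smul]
    have : d / (‖v‖ + d) + ‖v‖ / (‖v‖ + d) * -(d / ‖v‖) = 0 := by field_simp; ring
    rw [this, zero_smul]
  rw [h4, smul_eq_mul, smul_eq_mul] at h3
  have h5 : (‖v‖ + d) * Φ 0 ≤ d * Φ v + ‖v‖ * Φ x := by
    have := mul_le_mul_of_nonneg_left h3 (by positivity : 0 ≤ ‖v‖ + d)
    calc _ ≤ _ := this
      _ = _ := by field_simp
  have h6 : ‖v‖ * Φ x ≤ ‖v‖ * (Φ 0 + 1) := by gcongr; linarith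
  have h7 : d * (Φ 0 - 2 / δ * ‖v‖) ≤ d * Φ v := by
    have : d * (2 / δ * ‖v‖) = ‖v‖ := by rw [hdd]; field_simp
    rw [mul_sub, this]; linarith
  exact le_of_mul_le_mul_left h7 hd0

lemma aux_energy {i : V →L[ℝ] H} {a : V →L[ℝ] V →L[ℝ] ℝ} (ha_symm : ∀ u v : V, a u v = a v u)
    {lam : ℝ} (hlam : 0 < lam) (ha_coer : ∀ v : V, lam * ‖v‖ ^ 2 ≤ a v v)
    {Φ : V → ℝ} {K : Set V} {T : ℝ} {u_b : V} {g : ℝ → H} (hg : Continuous g)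
    {u : ℝ → V} {u' : ℝ → H}
    (hu : IsStrongSolution i a Φ K T u_b g u u') {t : ℝ} (ht : t ∈ Icc 0 T) :
    ∫ s in (0:ℝ)..t, ⟪g s - u' s, u' s⟫ =
      (a (u t) (u t) / 2 + Φ (u t)) - (a u_b u_b / 2 + Φ u_b) := by
  obtain ⟨hc, hc', hK, hd, h0, hineq⟩ := hu
  set E : ℝ → ℝ := fun s => a (u s) (u s) / 2 + Φ (u s) with hE
  have key : ∀ s ∈ Icc 0 T, ∀ r ∈ Icc 0 T,
      ⟪g r - u' r, i (u s) - i (u r)⟫ ≤ E s - E r := by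
    intro s hs r hr
    have h1 := hineq r hr (u s) (hK s hs)
    have h2 := ha_coer (u s - u r)
    have h3 : 0 ≤ lam * ‖u s - u r‖ ^ 2 := by positivity
    simp only [map_sub, sub_apply, ha_symm (u s) (u r)] at h1 h2
    simp only [hE, inner_sub_left] at h1 ⊢
    linarith
  have hder : ∀ r ∈ Icc 0 T, HasDerivWithinAt E ⟪g r - u' r, u' r⟫ (Icc 0 T) r := by
    intro r hr
    have hd1 : HasDerivAt (fun s => ⟪g r - u' r, i (u s)⟫) ⟪g r - u' r, u' r⟫ r := by
      simpa using (hasDerivAt_const r (g r - u' r)).inner ℝ (hd r hr)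
    have hd2 : HasDerivWithinAt (fun s => E s - ⟪g r - u' r, i (u s)⟫) 0 (Icc 0 T) r := by
      rw [hasDerivWithinAt_iff_isLittleO]
      have hO := (hd r hr).isBigO_sub
      have ho : (fun s => (g s - u' s) - (g r - u' r)) =o[𝓝 r] (fun _ => (1:ℝ)) := by
        rw [Asymptotics.isLittleO_one_iff]
        have : Continuous fun s => (g s - u' s) - (g r - u' r) := by fun_prop
        simpa using this.tendsto r
      have hprod := ((ho.norm_left.mul_isBigO hO.norm_left).mono
        (nhdsWithin_le_nhds (s := Icc 0 T)))
      simp only [one_mul] at hprod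
      refine Asymptotics.IsBigO.trans_isLittleO (Asymptotics.IsBigO.of_bound 1 ?_) hprod
      filter_upwards [self_mem_nhdsWithin] with s hs
      have k1 := key s hs r hr
      have k2 := key r hr s hs
      have k3 := real_inner_le_norm ((g s - u' s) - (g r - u' r)) (i (u s) - i (u r))
      have hnn : 0 ≤ ‖(g s - u' s) - (g r - u' r)‖ * ‖i (u s) - i (u r)‖ := by positivity
      rw [one_mul, Real.norm_of_nonneg hnn, smul_zero, sub_zero, Real.norm_eq_abs, abs_le]
      simp only [inner_sub_left, inner_sub_right] at k1 k2 k3 ⊢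
      constructor <;> linarith
    have hsum := hd2.add hd1.hasDerivWithinAt
    rw [zero_add] at hsum
    refine hsum.congr_of_mem (fun s _ => ?_) hr
    simp
  have := aux_ftc (e := fun r => ⟪g r - u' r, u' r⟫) (by fun_prop) le_rfl ht.1 ht.2 hder
  rw [this]
  simp [hE, h0]

lemma aux_bound {i : V →L[ℝ] H} {a : V →L[ℝ] V →L[ℝ] ℝ} (ha_symm : ∀ u v : V, a u v = a v u)
    {lam : ℝ} (hlam : 0 < lam) (ha_coer : ∀ v : V, lam * ‖v‖ ^ 2 ≤ a v v)
    {Φ : V → ℝ} (hΦ_conv : ConvexOn ℝ Set.univ Φ) (hΦ_cont : Continuous Φ)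
    {K : Set V} {T : ℝ} (u_b : V) (C : ℝ) :
    ∃ R : ℝ, ∀ (g : ℝ → H) (u : ℝ → V) (u' : ℝ → H), Continuous g →
      ∫ t in (0:ℝ)..T, ‖g t‖ ^ 2 ≤ C →
      IsStrongSolution i a Φ K T u_b g u u' → ∀ t ∈ Icc 0 T,
        ‖u t‖ ≤ R ∧ ∫ s in (0:ℝ)..t, ‖u' s‖ ^ 2 ≤ R := by
  obtain ⟨B, hB⟩ := aux_minorant hΦ_conv hΦ_cont
  set M := a u_b u_b / 2 + Φ u_b + C / 2 - Φ 0 + B ^ 2 / lam with hM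
  refine ⟨2 * M + (4 * M / lam + 1), fun g u u' hg hgC hu t ht => ?_⟩
  have hE := aux_energy ha_symm hlam ha_coer hg hu ht
  obtain ⟨hc, hc', -⟩ := hu
  have h1 : ∫ s in (0:ℝ)..t, ⟪g s - u' s, u' s⟫ ≤
      ∫ s in (0:ℝ)..t, (‖g s‖ ^ 2 / 2 - ‖u' s‖ ^ 2 / 2) := by
    apply aux_mono (by fun_prop) (by fun_prop) ht.1
    intro s _
    have := norm_sub_sq_real (g s) (u' s)
    rw [inner_sub_left, real_inner_self_eq_norm_sq]
    nlinarith [sq_nonneg ‖g s - u' s‖]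
  rw [intervalIntegral.integral_sub (Continuous.intervalIntegrable (by fun_prop) _ _)
    (Continuous.intervalIntegrable (by fun_prop) _ _), intervalIntegral.integral_div,
    intervalIntegral.integral_div] at h1
  have h2 : ∫ s in (0:ℝ)..t, ‖g s‖ ^ 2 ≤ ∫ s in (0:ℝ)..T, ‖g s‖ ^ 2 :=
    aux_mono_int (by fun_prop) (fun s => by positivity) le_rfl ht.1 ht.2
  have h3 : 0 ≤ ∫ s in (0:ℝ)..t, ‖u' s‖ ^ 2 :=
    intervalIntegral.integral_nonneg ht.1 fun s _ => by positivity
  have h4 := ha_coer (u t)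
  have h5 := hB (u t)
  have h6 : B * ‖u t‖ ≤ lam / 4 * ‖u t‖ ^ 2 + B ^ 2 / lam := by
    have : lam / 4 * ‖u t‖ ^ 2 + B ^ 2 / lam - B * ‖u t‖ = (lam / 2 * ‖u t‖ - B) ^ 2 / lam := by
      field_simp; ring
    have : 0 ≤ (lam / 2 * ‖u t‖ - B) ^ 2 / lam := by positivity
    linarith
  have h7 : lam / 4 * ‖u t‖ ^ 2 + (∫ s in (0:ℝ)..t, ‖u' s‖ ^ 2) / 2 ≤ M := by
    rw [hM]; linarith
  have h8 : 0 ≤ lam / 4 * ‖u t‖ ^ 2 := by positivity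
  have hM0 : 0 ≤ M := by linarith
  have h9 : ‖u t‖ ^ 2 ≤ 4 * M / lam := by
    rw [le_div_iff₀ hlam]; linarith
  have h10 : 0 ≤ 4 * M / lam := by positivity
  constructor
  · nlinarith [sq_nonneg (‖u t‖ - 1)]
  · linarith

lemma aux_diff {i : V →L[ℝ] H} {a : V →L[ℝ] V →L[ℝ] ℝ}
    {lam : ℝ} (ha_coer : ∀ v : V, lam * ‖v‖ ^ 2 ≤ a v v)
    {Φ : V → ℝ} {K : Set V} {T : ℝ} {u_b : V} {g₁ g₂ : ℝ → H} (hg₁ : Continuous g₁)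
    (hg₂ : Continuous g₂) {u₁ u₂ : ℝ → V} {u₁' u₂' : ℝ → H}
    (h₁ : IsStrongSolution i a Φ K T u_b g₁ u₁ u₁')
    (h₂ : IsStrongSolution i a Φ K T u_b g₂ u₂ u₂') {t : ℝ} (ht : t ∈ Icc 0 T) :
    ‖i (u₁ t) - i (u₂ t)‖ ^ 2 / 2 + lam * ∫ s in (0:ℝ)..t, ‖u₁ s - u₂ s‖ ^ 2 ≤
      ∫ s in (0:ℝ)..t, ⟪g₁ s - g₂ s, i (u₁ s) - i (u₂ s)⟫ := by
  obtain ⟨hc1, hc1', hK1, hd1, h01, hi1⟩ := h₁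
  obtain ⟨hc2, hc2', hK2, hd2, h02, hi2⟩ := h₂
  have hder : ∀ r ∈ Icc 0 T, HasDerivWithinAt (fun s => ‖i (u₁ s) - i (u₂ s)‖ ^ 2 / 2)
      ⟪i (u₁ r) - i (u₂ r), u₁' r - u₂' r⟫ (Icc 0 T) r := by
    intro r hr
    have := (((hd1 r hr).sub (hd2 r hr)).norm_sq).div_const 2
    refine (this.congr_deriv ?_).hasDerivWithinAt
    simp
  have hftc := aux_ftc (e := fun r => ⟪i (u₁ r) - i (u₂ r), u₁' r - u₂' r⟫)
    (by fun_prop) le_rfl ht.1 ht.2 hder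
  simp only [h01, h02, sub_self, norm_zero, ne_eq, OfNat.ofNat_ne_zero, not_false_eq_true,
    zero_pow, zero_div, sub_zero] at hftc
  rw [← hftc, ← intervalIntegral.integral_const_mul, ← intervalIntegral.integral_add
    (Continuous.intervalIntegrable (by fun_prop) _ _)
    (Continuous.intervalIntegrable (by fun_prop) _ _)]
  apply aux_mono (by fun_prop) (by fun_prop) ht.1
  intro s hs
  have hs' : s ∈ Icc 0 T := ⟨hs.1, hs.2.trans ht.2⟩
  have k1 := hi1 s hs' _ (hK2 s hs')
  have k2 := hi2 s hs' _ (hK1 s hs')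
  have k3 := ha_coer (u₁ s - u₂ s)
  rw [real_inner_comm]
  simp only [map_sub, sub_apply, inner_sub_left, inner_sub_right] at k1 k2 k3 ⊢
  linarith

lemma aux_holder {y y' : ℝ → H} (hy' : Continuous y') {T R : ℝ}
    (hd : ∀ t ∈ Icc 0 T, HasDerivAt y (y' t) t)
    (hR : ∫ s in (0:ℝ)..T, ‖y' s‖ ^ 2 ≤ R) {s t : ℝ} (hs : s ∈ Icc 0 T) (ht : t ∈ Icc 0 T)
    (hst : s ≤ t) : ‖y t - y s‖ ^ 2 ≤ (t - s) * R := by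
  rcases hst.eq_or_lt with rfl | hlt
  · simp
  set z := y t - y s with hz
  have hder : ∀ r ∈ Icc 0 T, HasDerivWithinAt (fun s => ⟪z, y s⟫) ⟪z, y' r⟫ (Icc 0 T) r := by
    intro r hr
    have : HasDerivAt (fun s => ⟪z, y s⟫) ⟪z, y' r⟫ r := by
      simpa using (hasDerivAt_const r z).inner ℝ (hd r hr)
    exact this.hasDerivWithinAt
  have hftc := aux_ftc (e := fun r => ⟪z, y' r⟫) (by fun_prop) hs.1 hst ht.2 hder
  have hδ : 0 < t - s := by linarith
  have h1 : ∫ r in s..t, ⟪z, y' r⟫ ≤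
      ∫ r in s..t, (‖z‖ ^ 2 / (2 * (t - s)) + (t - s) / 2 * ‖y' r‖ ^ 2) := by
    apply aux_mono (by fun_prop) (by fun_prop) hst
    intro r _
    have e1 := real_inner_le_norm z (y' r)
    have e2 : ‖z‖ ^ 2 / (2 * (t - s)) + (t - s) / 2 * ‖y' r‖ ^ 2 - ‖z‖ * ‖y' r‖ =
      (‖z‖ - (t - s) * ‖y' r‖) ^ 2 / (2 * (t - s)) := by field_simp; ring
    have e3 : 0 ≤ (‖z‖ - (t - s) * ‖y' r‖) ^ 2 / (2 * (t - s)) := by positivity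
    linarith
  rw [intervalIntegral.integral_add (Continuous.intervalIntegrable (by fun_prop) _ _)
    (Continuous.intervalIntegrable (by fun_prop) _ _), intervalIntegral.integral_const_mul,
    intervalIntegral.integral_const, hftc, ← inner_sub_right, ← hz,
    real_inner_self_eq_norm_sq, smul_eq_mul] at h1
  have h2 : ∫ r in s..t, ‖y' r‖ ^ 2 ≤ R :=
    (aux_mono_int (by fun_prop) (fun s => by positivity) hs.1 hst ht.2).trans hR
  have h3 : (t - s) * (‖z‖ ^ 2 / (2 * (t - s))) = ‖z‖ ^ 2 / 2 := by field_simp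
  rw [h3] at h1
  have h4 : (t - s) / 2 * ∫ r in s..t, ‖y' r‖ ^ 2 ≤ (t - s) / 2 * R := by gcongr
  linarith

end

/-- Assume in addition that `i : V → H` is a compact operator. If the controls
`gₙ` are bounded in `L²(0,T;H)` and converge weakly to `g` (tested against
continuous `φ : [0,T] → H`), then the corresponding solutions `uₙ` converge to
`u` strongly in `L²(0,T;V)` and `i ∘ uₙ → i ∘ u` uniformly on `[0,T]`
(Proposition 2.5 of the paper). -/
theorem stmt_5 {V H : Type*} [NormedAddCommGroup V] [InnerProductSpace ℝ V]
    [NormedAddCommGroup H] [InnerProductSpace ℝ H]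
    (i : V →L[ℝ] H) (hi_inj : Function.Injective i) (hi_dense : DenseRange i)
    (hi_compact : IsCompactOperator i)
    (a : V →L[ℝ] V →L[ℝ] ℝ) (ha_symm : ∀ u v : V, a u v = a v u)
    (lam : ℝ) (hlam : 0 < lam) (ha_coer : ∀ v : V, lam * ‖v‖ ^ 2 ≤ a v v)
    (Φ : V → ℝ) (hΦ_conv : ConvexOn ℝ Set.univ Φ) (hΦ_cont : Continuous Φ)
    (K : Set V) (hK_ne : K.Nonempty) (hK_closed : IsClosed K) (hK_conv : Convex ℝ K)
    (T : ℝ) (hT : 0 < T) (u_b : V) (hub : u_b ∈ K)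
    (g : ℝ → H) (hg : Continuous g)
    (gseq : ℕ → ℝ → H) (hgseq : ∀ n, Continuous (gseq n))
    (hbdd : ∃ C : ℝ, ∀ n, ∫ t in (0 : ℝ)..T, ‖gseq n t‖ ^ 2 ≤ C)
    (hweak : ∀ φ : ℝ → H, Continuous φ →
      Filter.Tendsto (fun n => ∫ t in (0 : ℝ)..T, ⟪gseq n t - g t, φ t⟫)
        Filter.atTop (nhds 0))
    (useq : ℕ → ℝ → V) (useq' : ℕ → ℝ → H) (u : ℝ → V) (u' : ℝ → H)
    (hn : ∀ n, IsStrongSolution i a Φ K T u_b (gseq n) (useq n) (useq' n))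
    (hu : IsStrongSolution i a Φ K T u_b g u u') :
    Filter.Tendsto (fun n => ∫ t in (0 : ℝ)..T, ‖useq n t - u t‖ ^ 2)
      Filter.atTop (nhds 0) ∧
    Filter.Tendsto (fun n => ⨆ t : Set.Icc (0 : ℝ) T, ‖i (useq n t) - i (u t)‖)
      Filter.atTop (nhds 0) := by
  obtain ⟨C, hC⟩ := hbdd
  obtain ⟨R, hR⟩ := aux_bound (i := i) (K := K) (T := T) ha_symm hlam ha_coer hΦ_conv hΦ_cont u_b C
  have hbd : ∀ n, ∀ t ∈ Icc 0 T, ‖useq n t‖ ≤ R ∧ ∫ s in (0:ℝ)..t, ‖useq' n s‖ ^ 2 ≤ R :=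
    fun n => hR _ _ _ (hgseq n) (hC n) (hn n)
  have hTm : T ∈ Icc 0 T := ⟨hT.le, le_rfl⟩
  have hcn : ∀ n, Continuous (useq n) := fun n => (hn n).1
  have hcu : Continuous u := hu.1
  set M : ℝ := 2 * C + 2 * ∫ t in (0:ℝ)..T, ‖g t‖ ^ 2 with hM
  have hMn : ∀ n, ∫ t in (0:ℝ)..T, ‖gseq n t - g t‖ ^ 2 ≤ M := by
    intro n
    have hgn := hgseq n
    have h1 : ∫ t in (0:ℝ)..T, ‖gseq n t - g t‖ ^ 2 ≤
        ∫ t in (0:ℝ)..T, (2 * ‖gseq n t‖ ^ 2 + 2 * ‖g t‖ ^ 2) := by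
      apply aux_mono (by fun_prop) (by fun_prop) hT.le
      intro s _
      have := norm_sub_le (gseq n s) (g s)
      have h0 := norm_nonneg (gseq n s - g s)
      nlinarith [sq_nonneg (‖gseq n s‖ - ‖g s‖)]
    rw [intervalIntegral.integral_add (Continuous.intervalIntegrable (by fun_prop) _ _)
      (Continuous.intervalIntegrable (by fun_prop) _ _), intervalIntegral.integral_const_mul,
      intervalIntegral.integral_const_mul] at h1
    linarith [hC n]
  have hD0 : ∀ n, 0 ≤ ∫ t in (0:ℝ)..T, ‖useq n t - u t‖ ^ 2 := fun n =>
    intervalIntegral.integral_nonneg hT.le fun s _ => by positivity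
  -- compactness in `C([0,T], H)`
  obtain ⟨S, hS, hSi⟩ := IsCompactOperator.image_closedBall_subset_compact
    (f := (i : V →ₗ[ℝ] H)) hi_compact R
  let F : ℕ → BoundedContinuousFunction (Icc (0:ℝ) T) H := fun n =>
    BoundedContinuousFunction.mkOfCompact
      ⟨fun t => i (useq n t), by have := hcn n; fun_prop⟩
  have hFapp : ∀ n t, F n t = i (useq n t) := fun n t => rfl
  have hR0 : 0 ≤ R := (norm_nonneg _).trans (hbd 0 T hTm).1
  have hcpt : IsCompact (closure (range F)) := by
    apply BoundedContinuousFunction.arzela_ascoli S hS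
    · rintro f t ⟨n, rfl⟩
      exact hSi ⟨useq n t, by simpa using (hbd n t t.2).1, rfl⟩
    · refine Metric.equicontinuous_of_continuity_modulus (fun d => Real.sqrt (d * R)) ?_ _ ?_
      · have : Continuous fun d : ℝ => Real.sqrt (d * R) := by fun_prop
        simpa using this.tendsto 0
      · rintro s t ⟨_, n, rfl⟩
        apply Real.le_sqrt_of_sq_le
        change dist (i (useq n s)) (i (useq n t)) ^ 2 ≤ _
        obtain ⟨-, hc', -, hd, -⟩ := hn n
        rw [Subtype.dist_eq, Real.dist_eq]
        rcases le_total (s:ℝ) t with h | h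
        · have := aux_holder hc' hd (hbd n T hTm).2 s.2 t.2 h
          rw [dist_comm, dist_eq_norm, abs_sub_comm, abs_of_nonneg (by linarith)]
          exact this
        · have := aux_holder hc' hd (hbd n T hTm).2 t.2 s.2 h
          rw [dist_eq_norm, abs_of_nonneg (by linarith)]
          exact this
  have hD : Tendsto (fun n => ∫ t in (0 : ℝ)..T, ‖useq n t - u t‖ ^ 2) atTop (𝓝 0) := by
    apply tendsto_of_subseq_tendsto
    intro ns hns
    obtain ⟨φ, -, ms, hms, hlim⟩ := hcpt.tendsto_subseq (x := F ∘ ns)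
      fun n => subset_closure (mem_range_self _)
    refine ⟨ms, ?_⟩
    let ψ : ℝ → H := IccExtend hT.le φ
    have hψ : Continuous ψ := φ.continuous.Icc_extend'
    have hψa : ∀ t (ht : t ∈ Icc 0 T), ψ t = φ ⟨t, ht⟩ := fun t ht => IccExtend_of_mem _ _ ht
    have hdist : Tendsto (fun k => dist (F (ns (ms k))) φ) atTop (𝓝 0) :=
      tendsto_iff_dist_tendsto_zero.1 hlim
    have hX : Tendsto (fun k => T * dist (F (ns (ms k))) φ ^ 2 / lam) atTop (𝓝 0) := by
      simpa using ((hdist.pow 2).const_mul T).div_const lam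
    have hZ : Tendsto (fun k => (∫ t in (0 : ℝ)..T,
        ⟪gseq (ns (ms k)) t - g t, ψ t - i (u t)⟫) / lam) atTop (𝓝 0) := by
      have := (hweak (fun t => ψ t - i (u t)) (by fun_prop)).comp
        (hns.comp hms.tendsto_atTop)
      simpa using this.div_const lam
    refine aux_lim (M := M / lam) (fun k => hD0 _) ?_ hX hZ
    intro k η hη
    set n := ns (ms k) with hnk
    have hgn := hgseq n
    have hun := hcn n
    have h1 := aux_diff ha_coer (hgseq n) hg (hn n) hu hTm
    have h2 : ∫ s in (0:ℝ)..T, ⟪gseq n s - g s, i (useq n s) - i (u s)⟫ =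
        (∫ s in (0:ℝ)..T, ⟪gseq n s - g s, i (useq n s) - ψ s⟫) +
        ∫ s in (0:ℝ)..T, ⟪gseq n s - g s, ψ s - i (u s)⟫ := by
      rw [← intervalIntegral.integral_add (Continuous.intervalIntegrable (by fun_prop) _ _)
        (Continuous.intervalIntegrable (by fun_prop) _ _)]
      congr 1
      ext s
      rw [← inner_add_right]
      congr 1
      abel
    have h3 := aux_amgm_int (h := fun s => gseq n s - g s) (y := fun s => i (useq n s) - ψ s)
      (by fun_prop) (by fun_prop) hη hTm
    have h4 : ∫ s in (0:ℝ)..T, ‖i (useq n s) - ψ s‖ ^ 2 ≤ T * dist (F n) φ ^ 2 := by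
      have : ∫ s in (0:ℝ)..T, ‖i (useq n s) - ψ s‖ ^ 2 ≤
          ∫ s in (0:ℝ)..T, dist (F n) φ ^ 2 := by
        apply aux_mono (by fun_prop) (by fun_prop) hT.le
        intro s hs
        have := BoundedContinuousFunction.dist_coe_le_dist (f := F n) (g := φ) ⟨s, hs⟩
        rw [hFapp, dist_eq_norm, ← hψa s hs] at this
        gcongr
      simpa using this
    have h5 := hMn n
    have h6 : (∫ s in (0:ℝ)..T, ‖i (useq n s) - ψ s‖ ^ 2) / η ≤ T * dist (F n) φ ^ 2 / η := by
      gcongr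
    have h7 : η * (∫ s in (0:ℝ)..T, ‖gseq n s - g s‖ ^ 2) ≤ η * M := by gcongr
    have h8 : 0 ≤ ‖i (useq n T) - i (u T)‖ ^ 2 / 2 := by positivity
    have h9 : lam * (∫ s in (0:ℝ)..T, ‖useq n s - u s‖ ^ 2) ≤ η * M + T * dist (F n) φ ^ 2 / η +
        ∫ s in (0:ℝ)..T, ⟪gseq n s - g s, ψ s - i (u s)⟫ := by linarith
    rw [mul_comm, ← le_div_iff₀ hlam] at h9
    refine h9.trans (le_of_eq ?_)
    field_simp
  refine ⟨hD, ?_⟩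
  have : Nonempty (Icc (0:ℝ) T) := ⟨⟨T, hTm⟩⟩
  have hsq : Tendsto (fun n => (⨆ t : Icc (0 : ℝ) T, ‖i (useq n t) - i (u t)‖) ^ 2)
      atTop (𝓝 0) := by
    have hX : Tendsto (fun n => 2 * (‖i‖ ^ 2 * ∫ t in (0 : ℝ)..T, ‖useq n t - u t‖ ^ 2))
        atTop (𝓝 0) := by
      simpa using (hD.const_mul (‖i‖ ^ 2)).const_mul 2
    refine aux_lim (M := 2 * M) (fun k => sq_nonneg _) ?_ hX tendsto_const_nhds
    intro n η hη
    have hgn := hgseq n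
    have hun := hcn n
    have hpt : ∀ t : Icc (0:ℝ) T, ‖i (useq n t) - i (u t)‖ ≤ Real.sqrt (η * (2 * M) +
        2 * (‖i‖ ^ 2 * ∫ t in (0 : ℝ)..T, ‖useq n t - u t‖ ^ 2) / η + 0) := by
      intro t
      apply Real.le_sqrt_of_sq_le
      have h1 := aux_diff ha_coer (hgseq n) hg (hn n) hu t.2
      have h3 := aux_amgm_int (h := fun s => gseq n s - g s)
        (y := fun s => i (useq n s) - i (u s)) (by fun_prop) (by fun_prop) hη t.2
      have h4 : ∫ s in (0:ℝ)..T, ‖i (useq n s) - i (u s)‖ ^ 2 ≤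
          ‖i‖ ^ 2 * ∫ t in (0 : ℝ)..T, ‖useq n t - u t‖ ^ 2 := by
        rw [← intervalIntegral.integral_const_mul]
        apply aux_mono (by fun_prop) (by fun_prop) hT.le
        intro s _
        rw [← map_sub, ← mul_pow]
        gcongr
        exact i.le_opNorm _
      have h6 : (∫ s in (0:ℝ)..T, ‖i (useq n s) - i (u s)‖ ^ 2) / η ≤
          (‖i‖ ^ 2 * ∫ t in (0 : ℝ)..T, ‖useq n t - u t‖ ^ 2) / η := by
        gcongr
      have h7 : η * (∫ s in (0:ℝ)..T, ‖gseq n s - g s‖ ^ 2) ≤ η * M := by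
        have := hMn n
        gcongr
      have h8 : 0 ≤ lam * ∫ s in (0:ℝ)..t, ‖useq n s - u s‖ ^ 2 :=
        mul_nonneg hlam.le (intervalIntegral.integral_nonneg t.2.1 fun s _ => by positivity)
      rw [mul_div_assoc]
      linarith
    have hM0 : 0 ≤ M := (intervalIntegral.integral_nonneg hT.le
      fun s _ => by positivity).trans (hMn n)
    have hDn := hD0 n
    have hsup := ciSup_le hpt
    calc _ ≤ _ := pow_le_pow_left₀ (Real.iSup_nonneg fun t => norm_nonneg _) hsup 2
      _ = _ := Real.sq_sqrt (by positivity)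
  have := hsq.sqrt
  simp only [Real.sqrt_zero] at this
  refine this.congr fun n => Real.sqrt_sq (Real.iSup_nonneg fun t => norm_nonneg _)
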